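/- arXiv:1508.06772 — 2 statements merged into one kernel-verified Lean document; each statement's English description precedes it below -/
import Mathlib

section
/- Let T be a (possibly unbounded) self-adjoint operator on a complex Hilbert space H with bounded transform S = T(I + T²)^{-1/2}. Then σ(S) is the closure in ℝ of the set { λ(1 + λ²)^{-1/2} : λ ∈ σ(T) }. -/
noncomputable section

variable {H : Type*} [NormedAddCommGroup H] [InnerProductSpace ℂ H] [CompleteSpace H]

/-- `S = T(I + T²)^{-1/2}`, the *bounded transform* of the (possibly unbounded) operator `T`.
This is witnessed by `C = (I + T²)⁻¹` (a positive bounded operator mapping into the domain of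
`T²` with `(I + T²) ∘ C = I`, which determines `C` uniquely when `T` is self-adjoint) together
with its (unique) positive square root `R = (I + T²)^{-1/2}`, and `S = T ∘ R`. -/
def IsBoundedTransform (T : H →ₗ.[ℂ] H) (S : H →L[ℂ] H) : Prop :=
  ∃ C R : H →L[ℂ] H, C.IsPositive ∧ R.IsPositive ∧ R * R = C ∧
    (∀ x : H, ∃ (h1 : C x ∈ T.domain) (h2 : (T ⟨C x, h1⟩ : H) ∈ T.domain),
        C x + T ⟨(T ⟨C x, h1⟩ : H), h2⟩ = x) ∧
    (∀ x : H, ∃ hx : R x ∈ T.domain, S x = T ⟨R x, hx⟩)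

/-- `S` is a pure contraction: `‖Sx‖ < ‖x‖` for all `x ≠ 0`. -/
def PureContraction (S : H →L[ℂ] H) : Prop := ∀ x : H, x ≠ 0 → ‖S x‖ < ‖x‖

/-- `T = S(I - S²)^{-1/2}`: witnessed by the (unique) positive square root `R` of `I - S²`,
with `D(T) = ran R` and `T ∘ R = S`. -/
def IsInverseBoundedTransform (S : H →L[ℂ] H) (T : H →ₗ.[ℂ] H) : Prop :=
  ∃ R : H →L[ℂ] H, R.IsPositive ∧ R * R = 1 - S * S ∧
    (T.domain : Set H) = Set.range R ∧
    (∀ x : H, ∃ hx : R x ∈ T.domain, (T ⟨R x, hx⟩ : H) = S x)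

/-- The resolvent set of an unbounded operator: `z` such that `T - z` has a (bounded,
everywhere defined) two-sided inverse. -/
def pmapResolventSet (T : H →ₗ.[ℂ] H) : Set ℂ :=
  {z | ∃ B : H →L[ℂ] H,
    (∀ x : H, ∃ h : B x ∈ T.domain, (T ⟨B x, h⟩ : H) - z • B x = x) ∧
    (∀ ψ : T.domain, B ((T ψ : H) - z • (ψ : H)) = ψ)}

/-- The spectrum of an unbounded operator. -/
def pmapSpectrum (T : H →ₗ.[ℂ] H) : Set ℂ := (pmapResolventSet T)ᶜ

/-- The real points of the spectrum of `T` (all of them, if `T` is self-adjoint). -/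
def realSpec (T : H →ₗ.[ℂ] H) : Set ℝ := {x : ℝ | (x : ℂ) ∈ pmapSpectrum T}

/-- `g(S)` for a function `g : ℝ → ℂ`, via the continuous functional calculus of `S`. -/
def boundedCalc (S : H →L[ℂ] H) (g : ℝ → ℂ) : H →L[ℂ] H :=
  cfc (fun z : ℂ => g z.re) S

/-- The homeomorphism `u : (-1,1) → ℝ`, `u(x) = x(1 - x²)^{-1/2}`. -/
def uFun : ℝ → ℝ := fun x => x / Real.sqrt (1 - x ^ 2)

/-- `h ∘ u`, extended by `0` outside `(-1,1)`. -/
def compU (h : ℝ → ℂ) : ℝ → ℂ :=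
  fun x => if x ∈ Set.Ioo (-1 : ℝ) 1 then h (uFun x) else 0

/-- `h(T) := (h ∘ u)(S)`, for a function `h` on `σ(T)`, where `S` is the bounded
transform of `T`. -/
def pmapCalc (S : H →L[ℂ] H) (h : ℝ → ℂ) : H →L[ℂ] H := boundedCalc S (compU h)

/-- `σ̃(S) = σ(S) ∩ (-1,1)`. -/
def tildeSpec (S : H →L[ℂ] H) : Set ℝ := spectrum ℝ S ∩ Set.Ioo (-1) 1

/-- `g ∈ C_c(Ω)`: continuous on `Ω`, vanishing outside a compact subset of `Ω`
(functions on `Ω` are encoded as functions on `ℝ` vanishing identically outside `Ω`). -/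
def MemCc (g : ℝ → ℂ) (Ω : Set ℝ) : Prop :=
  ContinuousOn g Ω ∧ ∃ K : Set ℝ, IsCompact K ∧ K ⊆ Ω ∧ ∀ x ∉ K, g x = 0

/-- `g ∈ C₀(Ω)`: continuous on `Ω` and vanishing at infinity on `Ω`. -/
def MemC0 (g : ℝ → ℂ) (Ω : Set ℝ) : Prop :=
  ContinuousOn g Ω ∧ (∀ x ∉ Ω, g x = 0) ∧
    ∀ ε > 0, ∃ K : Set ℝ, IsCompact K ∧ K ⊆ Ω ∧ ∀ x ∈ Ω \ K, ‖g x‖ < ε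

/-- `g ∈ C_b(Ω)`: continuous and bounded on `Ω`. -/
def MemCb (g : ℝ → ℂ) (Ω : Set ℝ) : Prop :=
  ContinuousOn g Ω ∧ ∃ M : ℝ, ∀ x ∈ Ω, ‖g x‖ ≤ M

/-- The supremum norm `‖f‖_∞` of `f` over `Ω`. -/
def supNorm (f : ℝ → ℂ) (Ω : Set ℝ) : ℝ := sSup ((fun x => ‖f x‖) '' Ω)

/-- The subspace `C*_c(S)H`: the linear span of all `g(S)ψ` with `g ∈ C_c(σ̃(S))`. -/
def ccSpan (S : H →L[ℂ] H) : Submodule ℂ H :=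
  Submodule.span ℂ
    {v : H | ∃ g : ℝ → ℂ, MemCc g (tildeSpec S) ∧ ∃ ψ : H, v = boundedCalc S g ψ}

/-- The subspace `C*₀(S)H`: the linear span of all `g(S)ψ` with `g ∈ C₀(σ̃(S))`. -/
def c0Span (S : H →L[ℂ] H) : Submodule ℂ H :=
  Submodule.span ℂ
    {v : H | ∃ g : ℝ → ℂ, MemC0 g (tildeSpec S) ∧ ∃ ψ : H, v = boundedCalc S g ψ}

/-- `TR ⊂ RT`: the bounded operator `R` commutes with the unbounded operator `T`. -/
def CommutesPMap (T : H →ₗ.[ℂ] H) (R : H →L[ℂ] H) : Prop :=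
  ∀ ψ : T.domain, ∃ h : R (ψ : H) ∈ T.domain, (T ⟨R (ψ : H), h⟩ : H) = R (T ψ)

/-- `A = f₀(T)`: the operator with domain `C*_c(S)H` determined by
`f₀(T) h(T)ψ = (fh)(T)ψ` for `h ∈ C_c(σ(T))` (where `σT` is the spectrum of `T`,
and `h(T) = (h∘u)(S)`). -/
def IsF0 (S : H →L[ℂ] H) (σT : Set ℝ) (f : ℝ → ℂ) (A : H →ₗ.[ℂ] H) : Prop :=
  A.domain = ccSpan S ∧
  ∀ h : ℝ → ℂ, MemCc h σT → ∀ ψ : H,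
    ∃ hm : pmapCalc S h ψ ∈ A.domain,
      A ⟨pmapCalc S h ψ, hm⟩ = pmapCalc S (fun x => f x * h x) ψ

/-- A bounded self-adjoint injective operator has dense range, so it cancels on the right. -/
theorem ContinuousLinearMap.mul_right_cancel_of_injective {R A B : H →L[ℂ] H}
    (hR : IsSelfAdjoint R) (hinj : Function.Injective R) (h : A * R = B * R) : A = B := by
  have h' : R * star A = R * star B := by
    simpa only [star_mul, hR.star_eq] using congrArg star h
  refine star_injective (ContinuousLinearMap.ext fun x => hinj ?_)
  exact congrArg (fun F : H →L[ℂ] H => F x) h'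

namespace LinearPMap

theorem inner_eq_inner_of_mem_graph {T : H →ₗ.[ℂ] H} (hsa : IsSelfAdjoint T)
    {x x' y y' : H} (hx : (x, x') ∈ T.graph) (hy : (y, y') ∈ T.graph) :
    inner ℂ x' y = inner ℂ x y' := by
  obtain ⟨a, rfl, rfl⟩ := T.mem_graph_iff.1 hx
  obtain ⟨b, rfl, rfl⟩ := T.mem_graph_iff.1 hy
  have h := adjoint_isFormalAdjoint hsa.dense_domain
  rw [isSelfAdjoint_def.1 hsa] at h
  exact h a b

/-- `I + T²` is injective for self-adjoint `T`. -/
theorem eq_zero_of_mem_graph_neg {T : H →ₗ.[ℂ] H} (hsa : IsSelfAdjoint T)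
    {x y : H} (hx : (x, y) ∈ T.graph) (hy : (y, -x) ∈ T.graph) : x = 0 := by
  have h := congrArg Complex.re (inner_eq_inner_of_mem_graph hsa hx hy)
  rw [inner_neg_right, Complex.neg_re] at h
  have h1 : (inner ℂ x x).re = ‖x‖ ^ 2 := inner_self_eq_norm_sq (𝕜 := ℂ) x
  have h2 : (inner ℂ y y).re = ‖y‖ ^ 2 := inner_self_eq_norm_sq (𝕜 := ℂ) y
  rw [h1, h2] at h
  have : ‖x‖ = 0 := by nlinarith [sq_nonneg ‖x‖, sq_nonneg ‖y‖]
  exact norm_eq_zero.1 this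

end LinearPMap

/-- The structure of the bounded transform: `S` is self-adjoint, `R = (I - S²)^{1/2}` is
injective, and the graph of `T` is `{(R x, S x)}`. -/
theorem IsBoundedTransform.exists_sqrt {T : H →ₗ.[ℂ] H} {S : H →L[ℂ] H}
    (hsa : IsSelfAdjoint T) (hbt : IsBoundedTransform T S) :
    ∃ R : H →L[ℂ] H, 0 ≤ R ∧ IsSelfAdjoint S ∧ R * R = 1 - S * S ∧ Function.Injective R ∧
      (∀ x, (R x, S x) ∈ T.graph) ∧ ∀ x x', (x, x') ∈ T.graph → ∃ z, R z = x := by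
  obtain ⟨C, R, -, hRpos, hRC, hC, hS⟩ := hbt
  have hR0 : 0 ≤ R := (ContinuousLinearMap.nonneg_iff_isPositive R).2 hRpos
  have hRsa : IsSelfAdjoint R := hRpos.isSelfAdjoint
  have hRRC : ∀ x, R (R x) = C x := fun x => congrArg (fun F : H →L[ℂ] H => F x) hRC
  have hRS : ∀ x, (R x, S x) ∈ T.graph := fun x => by
    obtain ⟨hx, h⟩ := hS x
    rw [h]
    exact T.mem_graph ⟨R x, hx⟩
  have hCS : ∀ x, (C x, S (R x)) ∈ T.graph := fun x => by
    rw [← hRRC]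
    exact hRS _
  have hCT : ∀ x, (S (R x), x - C x) ∈ T.graph := fun x => by
    obtain ⟨h1, h2, h⟩ := hC x
    have e : T ⟨C x, h1⟩ = S (R x) :=
      T.mem_graph_snd_inj (T.mem_graph ⟨C x, h1⟩) (hCS x) rfl
    have h3 := T.mem_graph ⟨T ⟨C x, h1⟩, h2⟩
    rw [← eq_sub_iff_add_eq'.2 h, ← e]
    exact h3
  have hinj : Function.Injective R := by
    refine (injective_iff_map_eq_zero R).2 fun x hx => ?_
    have h := hCT x
    rw [← hRRC, hx, map_zero, map_zero, sub_zero] at h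
    exact T.mem_graph_snd_inj h T.graph.zero_mem rfl
  have hcomm : ∀ x x', (x, x') ∈ T.graph → S (R x) = C x' := by
    intro x x' hx
    have h1 := T.graph.sub_mem (hCT x) (hCS x')
    have h2 := T.graph.sub_mem (T.graph.sub_mem hx (hCS x)) (hCT x')
    have e : x' - S (R x) - (x' - C x') = -(S (R x) - C x') := by abel
    simp only [Prod.mk_sub_mk, e] at h1 h2
    exact sub_eq_zero.1 (T.eq_zero_of_mem_graph_neg hsa h1 h2)
  have hSR : S * R = R * S := by
    have h1 : Commute C (S * R) := ContinuousLinearMap.ext fun x => (hcomm _ _ (hCS x)).symm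
    have h2 : Commute R (S * R) := by
      have h := h1.cfcₙ_nnreal NNReal.sqrt
      rwa [show cfcₙ NNReal.sqrt C = R from CFC.sqrt_unique hRC hR0] at h
    refine ContinuousLinearMap.mul_right_cancel_of_injective hRsa hinj ?_
    rw [mul_assoc R]
    exact h2.symm
  have hSRx : ∀ x, S (R x) = R (S x) := fun x => congrArg (fun F : H →L[ℂ] H => F x) hSR
  have hSsa : IsSelfAdjoint S := by
    refine ContinuousLinearMap.mul_right_cancel_of_injective hRsa hinj ?_
    rw [hSR]
    refine ContinuousLinearMap.ext fun x => ext_inner_right ℂ fun y => ?_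
    change inner ℂ (ContinuousLinearMap.adjoint S (R x)) y = inner ℂ (R (S x)) y
    rw [ContinuousLinearMap.adjoint_inner_left,
      ← LinearPMap.inner_eq_inner_of_mem_graph hsa (hRS x) (hRS y)]
    exact (hRpos.isSymmetric _ _).symm
  have hSS : ∀ x, S (S x) = x - C x := fun x => by
    refine T.mem_graph_snd_inj (hRS (S x)) (hCT x) ?_
    exact (hSRx x).symm
  refine ⟨R, hR0, hSsa, ?_, hinj, hRS, fun x x' hx => ⟨R x + S x', ?_⟩⟩
  · refine ContinuousLinearMap.ext fun x => ?_
    change R (R x) = x - S (S x)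
    rw [hSS, hRRC, sub_sub_cancel]
  · have h : S x = R x' := hinj (by rw [← hSRx, hcomm x x' hx, hRRC])
    rw [map_add, ← hSRx, ← h, hSS, hRRC, add_sub_cancel]

/-- `T - z` factors as `(S - zR) R⁻¹`. -/
theorem mem_pmapResolventSet_iff_isUnit {T : H →ₗ.[ℂ] H} {S R : H →L[ℂ] H}
    (hinj : Function.Injective R) (hRS : ∀ x, (R x, S x) ∈ T.graph)
    (hran : ∀ x x', (x, x') ∈ T.graph → ∃ z, R z = x) (z : ℂ) :
    z ∈ pmapResolventSet T ↔ IsUnit (S - z • R) := by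
  have hTR : ∀ x (h : R x ∈ T.domain), T ⟨R x, h⟩ = S x := fun x h =>
    T.mem_graph_snd_inj (T.mem_graph ⟨R x, h⟩) (hRS x) rfl
  constructor
  · rintro ⟨B, hB1, hB2⟩
    rw [ContinuousLinearMap.isUnit_iff_bijective]
    constructor
    · refine (injective_iff_map_eq_zero _).2 fun x hx => ?_
      have h : R x ∈ T.domain := LinearPMap.mem_domain_of_mem_graph (hRS x)
      have h2 := hB2 ⟨R x, h⟩
      rw [hTR] at h2
      change S x - z • R x = 0 at hx
      rw [hx, map_zero] at h2
      exact hinj (h2.symm.trans (map_zero R).symm)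
    · intro x
      obtain ⟨h, hx⟩ := hB1 x
      obtain ⟨w, hw⟩ := hran _ _ (T.mem_graph ⟨B x, h⟩)
      refine ⟨w, ?_⟩
      change S w - z • R w = x
      have h' : R w ∈ T.domain := LinearPMap.mem_domain_of_mem_graph (hRS w)
      have e : T ⟨B x, h⟩ = S w := T.mem_graph_snd_inj (T.mem_graph ⟨B x, h⟩) (hRS w) hw.symm
      rw [← e, hw]
      exact hx
  · rintro ⟨u, hu⟩
    have h1 : ∀ x, S ((↑u⁻¹ : H →L[ℂ] H) x) - z • R ((↑u⁻¹ : H →L[ℂ] H) x) = x := fun x => by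
      have := congrArg (fun F : H →L[ℂ] H => F x) u.mul_inv
      rw [hu] at this
      exact this
    have h2 : ∀ x, (↑u⁻¹ : H →L[ℂ] H) (S x - z • R x) = x := fun x => by
      have := congrArg (fun F : H →L[ℂ] H => F x) u.inv_mul
      rw [hu] at this
      exact this
    refine ⟨R * (↑u⁻¹ : H →L[ℂ] H), fun x => ?_, fun ψ => ?_⟩
    · refine ⟨LinearPMap.mem_domain_of_mem_graph (hRS _), ?_⟩
      refine Eq.trans ?_ (h1 x)
      congr 1
      exact hTR _ _
    · obtain ⟨w, hw⟩ := hran _ _ (T.mem_graph ψ)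
      have e : T ψ = S w := T.mem_graph_snd_inj (T.mem_graph ψ) (hRS w) hw.symm
      rw [e, ← hw]
      change R ((↑u⁻¹ : H →L[ℂ] H) (S w - z • R w)) = R w
      rw [h2]

section Spectrum

variable {R S : H →L[ℂ] H}

theorem one_sub_sq_nonneg_of_mem_spectrum (hR : 0 ≤ R) (hS : IsSelfAdjoint S)
    (hRS : R * R = 1 - S * S) {s : ℝ} (hs : s ∈ spectrum ℝ S) : 0 ≤ 1 - s ^ 2 := by
  have h : cfc (fun x : ℝ => 1 - x ^ 2) S = R * R := by
    rw [cfc_sub (fun _ : ℝ => (1 : ℝ)) (fun x => x ^ 2) S, cfc_const_one ℝ S, cfc_pow_id S 2,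
      hRS, sq]
  have h0 : 0 ≤ cfc (fun x : ℝ => 1 - x ^ 2) S := by
    rw [h]
    exact (IsSelfAdjoint.of_nonneg hR).mul_self_nonneg
  exact (cfc_nonneg_iff (fun x : ℝ => 1 - x ^ 2) S).1 h0 s hs

theorem eq_cfc_sqrt_one_sub_sq (hR : 0 ≤ R) (hS : IsSelfAdjoint S)
    (hRS : R * R = 1 - S * S) : R = cfc (fun x : ℝ => Real.sqrt (1 - x ^ 2)) S := by
  have h : cfc (fun x : ℝ => Real.sqrt (1 - x ^ 2)) S * cfc (fun x : ℝ => Real.sqrt (1 - x ^ 2)) S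
      = R * R := by
    rw [← cfc_mul (fun x : ℝ => Real.sqrt (1 - x ^ 2)) (fun x : ℝ => Real.sqrt (1 - x ^ 2)) S,
      cfc_congr (g := fun x : ℝ => 1 - x ^ 2) fun s hs => Real.mul_self_sqrt
        (one_sub_sq_nonneg_of_mem_spectrum hR hS hRS hs),
      cfc_sub (fun _ : ℝ => (1 : ℝ)) (fun x => x ^ 2) S, cfc_const_one ℝ S, cfc_pow_id S 2,
      hRS, sq]
  rw [← CFC.sqrt_unique h (cfc_nonneg fun x _ => Real.sqrt_nonneg _),
    CFC.sqrt_unique rfl hR]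

theorem eq_mul_sqrt_iff {s l : ℝ} (hs : 0 ≤ 1 - s ^ 2) :
    s - l * Real.sqrt (1 - s ^ 2) = 0 ↔ s = l / Real.sqrt (1 + l ^ 2) := by
  have hl : 0 < 1 + l ^ 2 := by positivity
  have hq : 0 < Real.sqrt (1 + l ^ 2) := Real.sqrt_pos.2 hl
  have hq2 : Real.sqrt (1 + l ^ 2) ^ 2 = 1 + l ^ 2 := Real.sq_sqrt hl.le
  constructor
  · intro h
    have hr2 := Real.sq_sqrt hs
    set r := Real.sqrt (1 - s ^ 2) with hr
    have hr0 : 0 ≤ r := Real.sqrt_nonneg _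
    have hsr : s = l * r := by linarith
    have h1 : (r * Real.sqrt (1 + l ^ 2)) ^ 2 = 1 := by
      have e : r ^ 2 * (1 + l ^ 2) = r ^ 2 + (l * r) ^ 2 := by ring
      rw [mul_pow, hq2, e, ← hsr, hr2, sub_add_cancel]
    have h2 : r * Real.sqrt (1 + l ^ 2) = 1 := by
      have := mul_nonneg hr0 hq.le
      nlinarith
    rw [eq_div_iff hq.ne', hsr, mul_assoc, h2, mul_one]
  · intro h
    have h1 : 1 - s ^ 2 = (1 / Real.sqrt (1 + l ^ 2)) ^ 2 := by
      rw [h, div_pow, div_pow, hq2]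
      field_simp
      ring
    rw [h1, Real.sqrt_sq (by positivity), h]
    ring

theorem isUnit_sub_smul_iff (hR : 0 ≤ R) (hS : IsSelfAdjoint S)
    (hRS : R * R = 1 - S * S) (l : ℝ) :
    IsUnit (S - (l : ℂ) • R) ↔ l / Real.sqrt (1 + l ^ 2) ∉ spectrum ℝ S := by
  have h : S - (l : ℂ) • R = cfc (fun x : ℝ => x - l * Real.sqrt (1 - x ^ 2)) S := by
    rw [cfc_sub (fun x : ℝ => x) (fun x => l * Real.sqrt (1 - x ^ 2)) S, cfc_id' ℝ S,
      cfc_const_mul l (fun x : ℝ => Real.sqrt (1 - x ^ 2)) S,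
      ← eq_cfc_sqrt_one_sub_sq hR hS hRS, Complex.coe_smul]
  rw [h, isUnit_cfc_iff (fun x : ℝ => x - l * Real.sqrt (1 - x ^ 2)) S]
  constructor
  · intro h' hmem
    exact h' _ hmem ((eq_mul_sqrt_iff
      (one_sub_sq_nonneg_of_mem_spectrum hR hS hRS hmem)).2 rfl)
  · intro h' s hs h0
    rw [eq_mul_sqrt_iff (one_sub_sq_nonneg_of_mem_spectrum hR hS hRS hs)] at h0
    exact h' (h0 ▸ hs)

/-- Since `I - S²` is injective, `±1` are not isolated points of the spectrum of `S`. -/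
theorem spectrum_subset_closure_tildeSpec (hR : 0 ≤ R) (hS : IsSelfAdjoint S)
    (hRS : R * R = 1 - S * S) (hinj : Function.Injective R) :
    spectrum ℝ S ⊆ closure (tildeSpec S) := by
  intro s hs
  by_contra hcl
  rw [Metric.mem_closure_iff] at hcl
  push Not at hcl
  obtain ⟨ε, hε, hfar⟩ := hcl
  let f : ℝ → ℝ := fun x => max 0 (ε - dist s x)
  have hf : Continuous f := by fun_prop
  have hRsa := IsSelfAdjoint.of_nonneg hR
  have h0 : cfc f S * R * R = 0 * R * R := by
    rw [mul_assoc, hRS, zero_mul, zero_mul]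
    have e : 1 - S * S = cfc (fun x : ℝ => 1 - x ^ 2) S := by
      rw [cfc_sub (fun _ : ℝ => (1 : ℝ)) (fun x => x ^ 2) S, cfc_const_one ℝ S,
        cfc_pow_id S 2, sq]
    rw [e, ← cfc_mul f (fun x : ℝ => 1 - x ^ 2) S, ← cfc_const_zero ℝ S]
    refine cfc_congr fun x hx => ?_
    have hx1 := one_sub_sq_nonneg_of_mem_spectrum hR hS hRS hx
    rcases hx1.eq_or_lt with h | h
    · simp [← h]
    · have hxt : x ∈ tildeSpec S := ⟨hx, by constructor <;> nlinarith⟩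
      have := hfar x hxt
      have hfx : f x = 0 := max_eq_left (by linarith)
      simp [hfx]
  have hf0 : cfc f S = cfc (fun _ : ℝ => (0 : ℝ)) S := by
    rw [cfc_const_zero ℝ S]
    exact ContinuousLinearMap.mul_right_cancel_of_injective hRsa hinj
      (ContinuousLinearMap.mul_right_cancel_of_injective hRsa hinj h0)
  have hfs : f s = 0 := eqOn_of_cfc_eq_cfc hf0 hf.continuousOn continuousOn_const hS hs
  have : f s = ε := by simp [f, hε.le]
  linarith

end Spectrum

/-- `σ(S) ∩ (-1,1)` is the image of `σ(T)`. -/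
theorem tildeSpec_eq_image_realSpec {T : H →ₗ.[ℂ] H} {S R : H →L[ℂ] H} (hR : 0 ≤ R)
    (hS : IsSelfAdjoint S) (hRR : R * R = 1 - S * S) (hinj : Function.Injective R)
    (hRS : ∀ x, (R x, S x) ∈ T.graph)
    (hran : ∀ x x', (x, x') ∈ T.graph → ∃ z, R z = x) :
    tildeSpec S = (fun l : ℝ => l / Real.sqrt (1 + l ^ 2)) '' realSpec T := by
  have key : ∀ l : ℝ, l ∈ realSpec T ↔ l / Real.sqrt (1 + l ^ 2) ∈ spectrum ℝ S := fun l => by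
    change ¬ ((l : ℂ) ∈ pmapResolventSet T) ↔ _
    rw [mem_pmapResolventSet_iff_isUnit hinj hRS hran, isUnit_sub_smul_iff hR hS hRR, not_not]
  ext s
  constructor
  · rintro ⟨hs, h1, h2⟩
    have hpos : 0 < 1 - s ^ 2 := by nlinarith
    have e : s = uFun s / Real.sqrt (1 + uFun s ^ 2) :=
      (eq_mul_sqrt_iff hpos.le).1 (by
        rw [uFun, div_mul_cancel₀ _ (Real.sqrt_pos.2 hpos).ne', sub_self])
    exact ⟨uFun s, (key _).2 (e ▸ hs), e.symm⟩
  · rintro ⟨l, hl, rfl⟩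
    have hq : 0 < Real.sqrt (1 + l ^ 2) := Real.sqrt_pos.2 (by positivity)
    have hlt : |l| < Real.sqrt (1 + l ^ 2) := by
      rw [← Real.sqrt_sq_eq_abs]
      exact Real.sqrt_lt_sqrt (sq_nonneg l) (by linarith)
    refine ⟨(key l).1 hl, abs_lt.1 ?_⟩
    rw [abs_div, abs_of_pos hq, div_lt_one hq]
    exact hlt

/-- `σ(S)` is the closure in `ℝ` of `{ λ(1 + λ²)^{-1/2} : λ ∈ σ(T) }`. -/
theorem spectrum_boundedTransform_eq_closure (T : H →ₗ.[ℂ] H) (S : H →L[ℂ] H)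
    (hdense : Dense (T.domain : Set H)) (hsa : IsSelfAdjoint T)
    (hbt : IsBoundedTransform T S) :
    spectrum ℂ S =
      Complex.ofReal ''
        closure ((fun l : ℝ => l / Real.sqrt (1 + l ^ 2)) '' realSpec T) := by
  obtain ⟨R, hR, hS, hRR, hinj, hRS, hran⟩ := hbt.exists_sqrt hsa
  have h : spectrum ℝ S = closure (tildeSpec S) :=
    (spectrum_subset_closure_tildeSpec hR hS hRR hinj).antisymm
      (closure_minimal Set.inter_subset_left (spectrum.isClosed S))
  rw [← tildeSpec_eq_image_realSpec hR hS hRR hinj hRS hran, ← h]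
  exact hS.spectrumRestricts.algebraMap_image.symm
end
end

section
/- Let T be a densely defined self-adjoint operator on a complex Hilbert space H with bounded transform S, σ̃(S) = σ(S) ∩ (-1,1), and u(x) = x(1 - x²)^{-1/2}. For every real-valued f ∈ C(σ(T)), the operator f₀(T), defined on the domain C*_c(S)H (the linear span of vectors g(S)ψ with g ∈ C_c(σ̃(S)), ψ ∈ H) by linear extension of f₀(T) h(T)ψ = (fh)(T)ψ for h ∈ C_c(σ(T)), is essentially self-adjoint; i.e., its closure f(T) = f₀(T)⁻ is a self-adjoint operator on H. -/
noncomputable section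

variable {H : Type*} [NormedAddCommGroup H] [InnerProductSpace ℂ H] [CompleteSpace H]

open Filter Topology in
/-- Let `a i`, `b i` be two families of bounded operators, closed under adjoints and intertwined by
`b j * a i = a j * b i`. If the `a i` contain an approximate unit, then `a i ψ ↦ b i ψ` defines
an essentially self-adjoint operator on the span of the ranges of the `a i`. -/
theorem LinearPMap.exists_isSelfAdjoint_closure_of_approximateUnit {ι : Type*}
    (a b : ι → H →L[ℂ] H)
    (hcomm : ∀ i j, b j * a i = a j * b i)
    (hstar : ∀ i, ∃ j, a j = star (a i) ∧ b j = star (b i)) (χ : ℕ → ι)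
    (hχ : ∀ x, Tendsto (fun n => a (χ n) x) atTop (𝓝 x)) :
    ∃ A : H →ₗ.[ℂ] H, A.domain = Submodule.span ℂ {v | ∃ i ψ, v = a i ψ} ∧
      (∀ i ψ, ∃ hm : a i ψ ∈ A.domain, A ⟨a i ψ, hm⟩ = b i ψ) ∧
      A.IsClosable ∧ IsSelfAdjoint A.closure := by
  set D : Submodule ℂ H := Submodule.span ℂ {v | ∃ i ψ, v = a i ψ} with hD
  have haD (i ψ) : a i ψ ∈ D := Submodule.subset_span ⟨i, ψ, rfl⟩
  have hcomm' (i j ψ) : b j (a i ψ) = a j (b i ψ) := congr($(hcomm i j) ψ)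
  let G : Submodule ℂ (H × H) := ⨅ i,
    LinearMap.eqLocus ((b i).toLinearMap ∘ₗ LinearMap.fst ℂ H H)
      ((a i).toLinearMap ∘ₗ LinearMap.snd ℂ H H)
  have hG {x y} : (x, y) ∈ G ↔ ∀ i, b i x = a i y := by simp [G]
  have hGfun : ∀ p ∈ G, p.1 = 0 → p.2 = 0 := by
    rintro ⟨x, y⟩ hp rfl
    have h (n) : a (χ n) y = 0 := by simpa using (hG.1 hp (χ n)).symm
    exact tendsto_nhds_unique (hχ y) (by simp [h])
  have habG (i ψ) : (a i ψ, b i ψ) ∈ G := hG.2 fun j => hcomm' i j ψ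
  let F : H →ₗ.[ℂ] H := G.toLinearPMap
  have hF : F.graph = G := G.toLinearPMap_graph_eq hGfun
  have hGc : _root_.IsClosed (G : Set (H × H)) := by
    have : (G : Set (H × H)) = ⋂ i, {p | b i p.1 = a i p.2} := by
      ext ⟨x, y⟩
      simp [hG]
    rw [this]
    exact isClosed_iInter fun i => isClosed_eq (by fun_prop) (by fun_prop)
  have hFc : F.IsClosed := by rw [LinearPMap.IsClosed, hF]; exact hGc
  have hDF : D ≤ F.domain := by
    refine Submodule.span_le.2 ?_
    rintro _ ⟨i, ψ, rfl⟩
    exact F.mem_domain_of_mem_graph (hF ▸ habG i ψ)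
  let A := F.domRestrict D
  have hAF : A ≤ F := LinearPMap.domRestrict_le
  have hA : A.domain = D := inf_eq_left.2 hDF
  have hAG (i ψ) : (a i ψ, b i ψ) ∈ A.graph := by
    have hm : a i ψ ∈ A.domain := hA ▸ haD i ψ
    have h : F ⟨a i ψ, hDF (haD i ψ)⟩ = b i ψ :=
      F.mem_graph_snd_inj (F.mem_graph _) (hF ▸ habG i ψ) rfl
    rw [LinearPMap.mem_graph_iff]
    exact ⟨⟨a i ψ, hm⟩, rfl, (hAF.2 rfl).trans h⟩
  have hAc : A.IsClosable := hFc.isClosable.leIsClosable hAF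
  have hcl : A.closure = F := by
    refine LinearPMap.eq_of_eq_graph ?_
    rw [← hAc.graph_closure_eq_closure_graph, hF]
    refine le_antisymm ?_ ?_
    · exact Submodule.topologicalClosure_minimal _ (hF ▸ LinearPMap.le_graph_of_le hAF) hGc
    · rintro ⟨x, y⟩ hxy
      refine mem_closure_of_tendsto ((hχ x).prodMk_nhds (hχ y)) (Eventually.of_forall fun n => ?_)
      rw [← hG.1 hxy]
      exact hAG (χ n) x
  have hdense : Dense (F.domain : Set H) := fun x =>
    mem_closure_of_tendsto (hχ x) (Eventually.of_forall fun n => hDF (haD _ x))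
  refine ⟨A, hA, fun i ψ => ⟨hA ▸ haD i ψ, ?_⟩, hAc, ?_⟩
  · exact A.mem_graph_snd_inj (A.mem_graph _) (hAG i ψ) rfl
  rw [hcl, LinearPMap.isSelfAdjoint_def]
  refine LinearPMap.eq_of_eq_graph ?_
  rw [LinearPMap.adjoint_graph_eq_graph_adjoint hdense, hF]
  ext ⟨x, y⟩
  simp only [Submodule.mem_adjoint_iff, sub_eq_zero]
  constructor
  · intro h
    refine hG.2 fun i => ?_
    obtain ⟨j, haj, hbj⟩ := hstar i
    refine ext_inner_left ℂ fun ψ => ?_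
    have := h _ _ (habG j ψ)
    simp only [haj, hbj, ContinuousLinearMap.star_eq_adjoint] at this
    simpa [ContinuousLinearMap.adjoint_inner_left] using this
  · intro h p q hpq
    refine tendsto_nhds_unique ((hχ q).inner tendsto_const_nhds)
      (((hχ p).inner tendsto_const_nhds).congr fun n => ?_)
    obtain ⟨j, haj, hbj⟩ := hstar (χ n)
    have h1 := hG.1 h j
    rw [haj, hbj, ContinuousLinearMap.star_eq_adjoint, ContinuousLinearMap.star_eq_adjoint] at h1
    rw [← hG.1 hpq, ← ContinuousLinearMap.adjoint_inner_right, ← h1,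
      ContinuousLinearMap.adjoint_inner_right]

/-- The algebraic identities between `S = T(I + T²)^{-1/2}` and the operator
`R = (I + T²)^{-1/2}`. -/
structure IsBoundedTransformPair (T : H →ₗ.[ℂ] H) (S R : H →L[ℂ] H) : Prop where
  isSelfAdjoint : IsSelfAdjoint S
  nonneg : 0 ≤ R
  injective : Function.Injective R
  denseRange : DenseRange R
  mul_self : R * R = 1 - S * S
  mem_domain_iff : ∀ y, y ∈ T.domain ↔ ∃ x, R x = y
  apply_eq : ∀ x (hx : R x ∈ T.domain), T ⟨R x, hx⟩ = S x

theorem ContinuousLinearMap.denseRange_of_isSelfAdjoint_of_injective {R : H →L[ℂ] H}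
    (hR : IsSelfAdjoint R) (hinj : Function.Injective R) : DenseRange R := by
  have h : R.rangeᗮ = ⊥ := by
    rw [ContinuousLinearMap.orthogonal_range, ← ContinuousLinearMap.star_eq_adjoint, hR.star_eq]
    exact LinearMap.ker_eq_bot.2 hinj
  have := (Submodule.topologicalClosure_eq_top_iff (K := R.range)).2 h
  exact Submodule.dense_iff_topologicalClosure_eq_top.2 this

theorem LinearPMap.inner_apply_of_isSelfAdjoint {T : H →ₗ.[ℂ] H} (hsa : IsSelfAdjoint T)
    (x y : T.domain) : inner ℂ (T x) (y : H) = inner ℂ (x : H) (T y) := by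
  have h := LinearPMap.adjoint_isFormalAdjoint hsa.dense_domain
  rw [LinearPMap.isSelfAdjoint_def.1 hsa] at h
  exact h x y

theorem LinearPMap.eq_zero_of_add_apply_apply_eq_zero {T : H →ₗ.[ℂ] H} (hsa : IsSelfAdjoint T)
    (x : T.domain) (hx : T x ∈ T.domain) (h : (x : H) + T ⟨T x, hx⟩ = 0) : (x : H) = 0 := by
  have h1 : inner ℂ (x : H) ((x : H) + T ⟨T x, hx⟩) = 0 := by rw [h, inner_zero_right]
  rw [inner_add_right, ← LinearPMap.inner_apply_of_isSelfAdjoint hsa x ⟨T x, hx⟩] at h1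
  have h2 : ‖(x : H)‖ ^ 2 + ‖T x‖ ^ 2 = 0 := by
    rw [inner_self_eq_norm_sq_to_K, inner_self_eq_norm_sq_to_K] at h1
    simpa [← Complex.ofReal_pow] using congrArg Complex.re h1
  have : ‖(x : H)‖ ^ 2 = 0 := by nlinarith [sq_nonneg ‖(x : H)‖, sq_nonneg ‖T x‖]
  simpa using this

theorem IsBoundedTransform.exists_pair {T : H →ₗ.[ℂ] H} {S : H →L[ℂ] H} (hsa : IsSelfAdjoint T)
    (hbt : IsBoundedTransform T S) : ∃ R, IsBoundedTransformPair T S R := by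
  obtain ⟨C, R, hC, hR, hRR, hCT, hST⟩ := hbt
  choose hC1 hC2 hC3 using hCT
  choose hR1 hS using hST
  have hRR' (x) : R (R x) = C x := congr($hRR x)
  have hRsa : IsSelfAdjoint R := hR.isSelfAdjoint
  have hinj : Function.Injective R := by
    refine (injective_iff_map_eq_zero R).2 fun x hx => ?_
    have h0 : (⟨C x, hC1 x⟩ : T.domain) = 0 := Subtype.ext (by simp [← hRR', hx])
    have h1 : (⟨T ⟨C x, hC1 x⟩, hC2 x⟩ : T.domain) = 0 :=
      Subtype.ext ((congrArg T h0).trans T.map_zero)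
    refine (hC3 x).symm.trans ?_
    rw [h1, LinearPMap.map_zero, add_zero]
    exact congrArg Subtype.val h0
  have hdr := ContinuousLinearMap.denseRange_of_isSelfAdjoint_of_injective hRsa hinj
  have cancel_right {A B : H →L[ℂ] H} (h : A * R = B * R) : A = B :=
    DFunLike.coe_injective <| hdr.equalizer A.continuous B.continuous <|
      funext fun x => congr($h x)
  have cancel_left {A B : H →L[ℂ] H} (h : R * A = R * B) : A = B :=
    ContinuousLinearMap.ext fun x => hinj congr($h x)
  -- `C` commutes with `T`
  have hTC (y : T.domain) : T ⟨C y, hC1 y⟩ = C (T y) := by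
    have hTT : T ⟨T ⟨C y, hC1 y⟩, hC2 y⟩ = (y : H) - C y := by
      rw [eq_sub_iff_add_eq', hC3]
    set v : T.domain := ⟨T ⟨C y, hC1 y⟩, hC2 y⟩ with hv
    have hTv : T v ∈ T.domain := by rw [hTT]; exact T.domain.sub_mem y.2 (hC1 y)
    have hTTv : T ⟨T v, hTv⟩ = T y - v := by
      have : (⟨T v, hTv⟩ : T.domain) = y - ⟨C y, hC1 y⟩ := Subtype.ext hTT
      rw [this, LinearPMap.map_sub]
    set w : T.domain := ⟨C (T y), hC1 _⟩ with hw
    have hTw : T w ∈ T.domain := hC2 _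
    have hTTw : T ⟨T w, hTw⟩ = T y - w := by
      rw [eq_sub_iff_add_eq']
      exact hC3 _
    have hTvw : T (v - w) ∈ T.domain := by
      rw [LinearPMap.map_sub]; exact T.domain.sub_mem hTv hTw
    have hz := LinearPMap.eq_zero_of_add_apply_apply_eq_zero hsa (v - w) hTvw (by
      have : (⟨T (v - w), hTvw⟩ : T.domain) = ⟨T v, hTv⟩ - ⟨T w, hTw⟩ :=
        Subtype.ext (T.map_sub v w)
      rw [this, LinearPMap.map_sub, hTTv, hTTw]
      simp)
    exact sub_eq_zero.1 hz
  have hSR (x) : (S * R) x = T ⟨C x, hC1 x⟩ := by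
    rw [mul_apply_eq_comp, hS]
    congr 2
    exact hRR' x
  have hadj (y : T.domain) : star S y = R (T y) := by
    refine ext_inner_left ℂ fun x => ?_
    rw [ContinuousLinearMap.star_eq_adjoint, ContinuousLinearMap.adjoint_inner_right, hS,
      LinearPMap.inner_apply_of_isSelfAdjoint hsa ⟨R x, hR1 x⟩ y]
    exact hR.isSymmetric x (T y)
  have hRS' : R * star S = S * R := by
    refine DFunLike.coe_injective <| (R * star S).continuous.ext_on hsa.dense_domain
      (S * R).continuous fun y hy => ?_
    rw [hSR, hTC ⟨y, hy⟩, ← hRR', ← hadj ⟨y, hy⟩]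
    rfl
  have hcommC : Commute (S * R) C := by
    ext x
    refine (hSR _).trans (Eq.trans ?_ congr(C $((hSR x).symm)))
    exact hTC ⟨C x, hC1 x⟩
  have hcommR : Commute (S * R) R := by
    have : R = CFC.sqrt C :=
      (CFC.sqrt_unique hRR ((ContinuousLinearMap.nonneg_iff_isPositive R).2 hR)).symm
    have h := (hcommC.symm.cfc_nnreal NNReal.sqrt).symm
    rwa [← CFC.sqrt_eq_cfc, ← this] at h
  have hSRcomm : S * R = R * S := cancel_right <| by
    rw [mul_assoc R, ← hcommR.eq]
  have hSsa : IsSelfAdjoint S := cancel_left (by rw [hRS', hSRcomm])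
  have hSS : S * S = 1 - R * R := by
    refine cancel_left (cancel_right (B := R * (1 - R * R)) ?_)
    ext x
    have h1 : (R * (S * S) * R) x = (S * R) ((S * R) x) := by
      rw [← mul_assoc, ← hSRcomm]
      rfl
    have h2 : (S * R) ((S * R) x) = C (x - C x) := by
      rw [hSR x, hSR]
      have := hTC ⟨T ⟨C x, hC1 x⟩, hC2 x⟩
      rw [this]
      congr 1
      rw [eq_sub_iff_add_eq', hC3]
    rw [h1, h2]
    simp [hRR']
  refine ⟨R, hSsa, (ContinuousLinearMap.nonneg_iff_isPositive R).2 hR, hinj, hdr,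
    by rw [hSS, sub_sub_cancel], fun y => ⟨fun hy => ?_, ?_⟩, fun x hx => (hS x).symm⟩
  · refine ⟨R y + S (T ⟨y, hy⟩), ?_⟩
    have h1 : S y = R (T ⟨y, hy⟩) := by rw [← hadj ⟨y, hy⟩, hSsa.star_eq]
    have h2 : R (S (T ⟨y, hy⟩)) = S (S y) := by
      rw [h1]
      exact congr($hSRcomm.symm (T ⟨y, hy⟩))
    have h3 : S (S y) = y - R (R y) := congr($hSS y)
    rw [map_add, h2, h3, add_sub_cancel]
  · rintro ⟨x, rfl⟩
    exact hR1 x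

namespace IsBoundedTransformPair

variable {T : H →ₗ.[ℂ] H} {S R : H →L[ℂ] H}

theorem sq_le_one (h : IsBoundedTransformPair T S R) {x : ℝ} (hx : x ∈ spectrum ℝ S) :
    0 ≤ 1 - x ^ 2 := by
  have hS := h.isSelfAdjoint
  have h1 : cfc (fun x : ℝ => 1 - x ^ 2) S = R * R := by
    rw [h.mul_self, cfc_sub .., cfc_const_one .., cfc_pow_id .., pow_two]
  have h2 : 0 ≤ R * R := (IsSelfAdjoint.of_nonneg h.nonneg).mul_self_nonneg
  rw [← h1, cfc_nonneg_iff ..] at h2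
  exact h2 x hx

theorem eq_cfc (h : IsBoundedTransformPair T S R) : R = cfc (fun x : ℝ => √(1 - x ^ 2)) S := by
  have hS := h.isSelfAdjoint
  refine (CFC.mul_self_eq_mul_self_iff _ _ h.nonneg (cfc_nonneg fun x _ => by positivity)).1 ?_
  rw [← cfc_mul .., h.mul_self]
  rw [cfc_congr (g := fun x : ℝ => 1 - x ^ 2) fun x hx => Real.mul_self_sqrt (h.sq_le_one hx)]
  rw [cfc_sub .., cfc_const_one .., cfc_pow_id .., pow_two]

theorem isUnit_sub_smul_iff (h : IsBoundedTransformPair T S R) (c : ℝ) :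
    IsUnit (S - c • R) ↔ ∀ x ∈ spectrum ℝ S, x - c * √(1 - x ^ 2) ≠ 0 := by
  have hS := h.isSelfAdjoint
  rw [← isUnit_cfc_iff (fun x : ℝ => x - c * √(1 - x ^ 2)) S, cfc_sub .., cfc_id' ..,
    cfc_const_mul .., ← h.eq_cfc]

theorem mem_pmapResolventSet_iff (h : IsBoundedTransformPair T S R) (c : ℝ) :
    (c : ℂ) ∈ pmapResolventSet T ↔ IsUnit (S - c • R) := by
  have hR (x) : R x ∈ T.domain := (h.mem_domain_iff _).2 ⟨x, rfl⟩
  have hTR (x) : T ⟨R x, hR x⟩ - (c : ℂ) • R x = (S - c • R) x := by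
    rw [h.apply_eq]
    simp
  constructor
  · rintro ⟨B, hB, hB'⟩
    rw [ContinuousLinearMap.isUnit_iff_bijective]
    constructor
    · refine (injective_iff_map_eq_zero _).2 fun x hx => ?_
      have := hB' ⟨R x, hR x⟩
      rw [hTR, hx, map_zero] at this
      exact (injective_iff_map_eq_zero R).1 h.injective _ this.symm
    · intro y
      obtain ⟨hy, e⟩ := hB y
      obtain ⟨x, hx⟩ := (h.mem_domain_iff _).1 hy
      refine ⟨x, ?_⟩
      rw [← hTR, ← e]
      simp only [hx]
  · rintro ⟨U, hU⟩
    refine ⟨R * (↑U⁻¹ : H →L[ℂ] H), fun x => ⟨hR _, ?_⟩, ?_⟩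
    · refine (hTR _).trans ?_
      rw [← hU]
      exact congr($(U.mul_inv) x)
    · rintro ⟨y, hy⟩
      obtain ⟨x, rfl⟩ := (h.mem_domain_iff y).1 hy
      rw [hTR, ← hU]
      exact congr(R ($(U.inv_mul) x))

end IsBoundedTransformPair

/-- The inverse of `uFun : (-1,1) → ℝ`. -/
def uInv (y : ℝ) : ℝ := y / √(1 + y ^ 2)

theorem one_sub_uInv_sq (y : ℝ) : 1 - uInv y ^ 2 = (1 + y ^ 2)⁻¹ := by
  have : 0 < 1 + y ^ 2 := by positivity
  rw [uInv, div_pow, Real.sq_sqrt this.le]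
  field_simp
  ring

theorem uInv_mem_Ioo (y : ℝ) : uInv y ∈ Set.Ioo (-1 : ℝ) 1 := by
  have h : 0 < 1 - uInv y ^ 2 := by rw [one_sub_uInv_sq]; positivity
  exact abs_lt.1 ((sq_lt_one_iff_abs_lt_one _).1 (by linarith))

theorem uFun_uInv (y : ℝ) : uFun (uInv y) = y := by
  have : 0 < 1 + y ^ 2 := by positivity
  rw [uFun, one_sub_uInv_sq, Real.sqrt_inv, uInv, div_inv_eq_mul,
    div_mul_cancel₀ _ (by positivity)]

theorem one_sub_sq_pos {x : ℝ} (hx : x ∈ Set.Ioo (-1 : ℝ) 1) : 0 < 1 - x ^ 2 := by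
  nlinarith [hx.1, hx.2]

theorem uInv_uFun {x : ℝ} (hx : x ∈ Set.Ioo (-1 : ℝ) 1) : uInv (uFun x) = x := by
  have h := one_sub_sq_pos hx
  have h1 : 1 + uFun x ^ 2 = (1 - x ^ 2)⁻¹ := by
    rw [uFun, div_pow, Real.sq_sqrt h.le]
    field_simp
    ring
  rw [uInv, h1, Real.sqrt_inv, uFun, div_inv_eq_mul, div_mul_cancel₀ _ (by positivity)]

theorem continuous_uInv : Continuous uInv := by
  unfold uInv
  exact continuous_id.div (by fun_prop) fun y => by positivity

theorem continuousOn_uFun : ContinuousOn uFun (Set.Ioo (-1) 1) := by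
  unfold uFun
  refine continuousOn_id.div (by fun_prop) fun x hx => ?_
  have := one_sub_sq_pos hx
  positivity

namespace IsBoundedTransformPair

variable {T : H →ₗ.[ℂ] H} {S R : H →L[ℂ] H}

theorem uFun_mem_realSpec_iff (h : IsBoundedTransformPair T S R) {x : ℝ}
    (hx : x ∈ Set.Ioo (-1 : ℝ) 1) : uFun x ∈ realSpec T ↔ x ∈ tildeSpec S := by
  rw [realSpec, Set.mem_ofPred_eq, pmapSpectrum, Set.mem_compl_iff, h.mem_pmapResolventSet_iff,
    h.isUnit_sub_smul_iff]
  push Not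
  constructor
  · rintro ⟨y, hy, e⟩
    suffices y = x from this ▸ ⟨hy, this ▸ hx⟩
    have hy1 : 0 < 1 - y ^ 2 := by
      refine (h.sq_le_one hy).lt_of_ne fun h0 => ?_
      rw [← h0, Real.sqrt_zero, mul_zero, sub_zero] at e
      simp [e] at h0
    have hy2 : y ∈ Set.Ioo (-1 : ℝ) 1 :=
      abs_lt.1 ((sq_lt_one_iff_abs_lt_one _).1 (by linarith))
    rw [← uInv_uFun hy2, ← uInv_uFun hx]
    congr 1
    rw [uFun, div_eq_iff (by positivity)]
    linarith
  · rintro ⟨hxs, -⟩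
    have := one_sub_sq_pos hx
    refine ⟨x, hxs, ?_⟩
    rw [uFun, div_mul_cancel₀ _ (by positivity), sub_self]

theorem memCc_compU (h : IsBoundedTransformPair T S R) {g : ℝ → ℂ}
    (hg : MemCc g (realSpec T)) : MemCc (compU g) (tildeSpec S) := by
  obtain ⟨hgc, K, hK, hKs, hg0⟩ := hg
  refine ⟨?_, uInv '' K, hK.image continuous_uInv, ?_, fun x hx => ?_⟩
  · refine (hgc.comp (continuousOn_uFun.mono Set.inter_subset_right) fun x hx =>
      (h.uFun_mem_realSpec_iff hx.2).2 hx).congr fun x hx => if_pos hx.2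
  · rintro _ ⟨y, hy, rfl⟩
    rw [← h.uFun_mem_realSpec_iff (uInv_mem_Ioo y), uFun_uInv]
    exact hKs hy
  · unfold compU
    split_ifs with hx1
    · exact hg0 _ fun hK => hx ⟨_, hK, uInv_uFun hx1⟩
    · rfl

end IsBoundedTransformPair

theorem MemCc.continuousOn_spectrum {E : Type*} [NormedAddCommGroup E] [InnerProductSpace ℂ E]
    {S : E →L[ℂ] E} {g : ℝ → ℂ} (hg : MemCc g (tildeSpec S)) :
    ContinuousOn g (spectrum ℝ S) := by
  obtain ⟨hgc, K, hK, hKs, hg0⟩ := hg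
  intro x hx
  by_cases hxK : x ∈ K
  · have h1 := hgc x (hKs hxK)
    rw [tildeSpec, ContinuousWithinAt,
      nhdsWithin_inter_of_mem' (nhdsWithin_le_nhds (isOpen_Ioo.mem_nhds (hKs hxK).2))] at h1
    exact h1
  · refine (continuousAt_const (y := (0 : ℂ))).congr ?_ |>.continuousWithinAt
    filter_upwards [hK.isClosed.isOpen_compl.mem_nhds hxK] with y hy using (hg0 y hy).symm

theorem MemCc.star {g : ℝ → ℂ} {Ω : Set ℝ} (hg : MemCc g Ω) :
    MemCc (fun x => star (g x)) Ω := by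
  obtain ⟨hgc, K, hK, hKs, hg0⟩ := hg
  exact ⟨hgc.star, K, hK, hKs, fun x hx => by simp [hg0 x hx]⟩

theorem MemCc.mul_left {f g : ℝ → ℂ} {Ω : Set ℝ} (hf : ContinuousOn f Ω) (hg : MemCc g Ω) :
    MemCc (fun x => f x * g x) Ω := by
  obtain ⟨hgc, K, hK, hKs, hg0⟩ := hg
  exact ⟨hf.mul hgc, K, hK, hKs, fun x hx => by simp [hg0 x hx]⟩

section boundedCalc

variable {S : H →L[ℂ] H}

theorem re_mem_spectrum (hS : IsSelfAdjoint S) {z : ℂ} (hz : z ∈ spectrum ℂ S) :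
    z.re ∈ spectrum ℝ S := by
  rw [← spectrum.algebraMap_mem_iff ℂ]
  rwa [hS.mem_spectrum_eq_re hz] at hz

theorem continuousOn_comp_re (hS : IsSelfAdjoint S) {g : ℝ → ℂ}
    (hg : ContinuousOn g (spectrum ℝ S)) :
    ContinuousOn (fun z : ℂ => g z.re) (spectrum ℂ S) :=
  hg.comp Complex.continuous_re.continuousOn fun _ => re_mem_spectrum hS

theorem boundedCalc_mul (hS : IsSelfAdjoint S) {g k : ℝ → ℂ}
    (hg : ContinuousOn g (spectrum ℝ S)) (hk : ContinuousOn k (spectrum ℝ S)) :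
    boundedCalc S (fun x => g x * k x) = boundedCalc S g * boundedCalc S k :=
  cfc_mul _ _ S (continuousOn_comp_re hS hg) (continuousOn_comp_re hS hk)

theorem boundedCalc_sub (hS : IsSelfAdjoint S) {g k : ℝ → ℂ}
    (hg : ContinuousOn g (spectrum ℝ S)) (hk : ContinuousOn k (spectrum ℝ S)) :
    boundedCalc S (fun x => g x - k x) = boundedCalc S g - boundedCalc S k :=
  cfc_sub _ _ S (continuousOn_comp_re hS hg) (continuousOn_comp_re hS hk)

theorem boundedCalc_star (g : ℝ → ℂ) :
    boundedCalc S (fun x => star (g x)) = star (boundedCalc S g) :=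
  cfc_star _ S

theorem norm_boundedCalc_le (hS : IsSelfAdjoint S) {g : ℝ → ℂ} {c : ℝ} (hc : 0 ≤ c)
    (h : ∀ x ∈ spectrum ℝ S, ‖g x‖ ≤ c) : ‖boundedCalc S g‖ ≤ c :=
  norm_cfc_le hc fun _ hz => h _ (re_mem_spectrum hS hz)

theorem boundedCalc_one_sub_sq (hS : IsSelfAdjoint S) :
    boundedCalc S (fun x => 1 - (x : ℂ) ^ 2) = 1 - S * S := by
  have hS' : IsStarNormal S := hS.isStarNormal
  have h : boundedCalc S (fun x => 1 - (x : ℂ) ^ 2) = cfc (fun z : ℂ => 1 - z ^ 2) S :=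
    cfc_congr fun z hz => by
      have := hS.mem_spectrum_eq_re hz
      simp only [← this]
  rw [h, cfc_sub .., cfc_const_one .., cfc_pow_id .., pow_two]

end boundedCalc

/-- A continuous cutoff, vanishing where `1 - x²` is small. -/
def edgeCutoff (n : ℕ) (x : ℝ) : ℝ := max 0 (min 1 ((n + 1) * (1 - x ^ 2) - 1))

theorem continuous_edgeCutoff (n : ℕ) : Continuous (edgeCutoff n) := by
  unfold edgeCutoff
  fun_prop

theorem edgeCutoff_nonneg (n : ℕ) (x : ℝ) : 0 ≤ edgeCutoff n x := le_max_left _ _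

theorem edgeCutoff_le_one (n : ℕ) (x : ℝ) : edgeCutoff n x ≤ 1 :=
  max_le zero_le_one (min_le_left _ _)

theorem edgeCutoff_eq_zero {n : ℕ} {x : ℝ} (h : (n + 1) * (1 - x ^ 2) ≤ 1) :
    edgeCutoff n x = 0 :=
  max_eq_left ((min_le_right _ _).trans (by linarith))

theorem one_sub_edgeCutoff_mul_le (n : ℕ) {x : ℝ} (hx : 0 ≤ 1 - x ^ 2) :
    (1 - edgeCutoff n x) * (1 - x ^ 2) ≤ 2 / (n + 1) := by
  have hn : (0 : ℝ) < n + 1 := by positivity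
  rcases le_total 2 ((n + 1) * (1 - x ^ 2)) with h | h
  · have : edgeCutoff n x = 1 := by
      rw [edgeCutoff, min_eq_left (by linarith), max_eq_right zero_le_one]
    rw [this, sub_self, zero_mul]
    positivity
  · rw [le_div_iff₀ hn]
    nlinarith [edgeCutoff_nonneg n x, mul_nonneg (edgeCutoff_nonneg n x) (mul_nonneg hn.le hx)]

open Classical in
/-- The cutoff `edgeCutoff n`, restricted to the spectrum of `S`. -/
def spectralCutoff (S : H →L[ℂ] H) (n : ℕ) (x : ℝ) : ℂ :=
  if x ∈ spectrum ℝ S then edgeCutoff n x else 0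

theorem spectralCutoff_eqOn {E : Type*} [NormedAddCommGroup E] [InnerProductSpace ℂ E]
    (S : E →L[ℂ] E) (n : ℕ) :
    (spectrum ℝ S).EqOn (spectralCutoff S n) fun x => (edgeCutoff n x : ℂ) :=
  fun _ hx => if_pos hx

theorem memCc_spectralCutoff (S : H →L[ℂ] H) (n : ℕ) :
    MemCc (spectralCutoff S n) (tildeSpec S) := by
  have hn : (0 : ℝ) < n + 1 := by positivity
  refine ⟨?_, spectrum ℝ S ∩ {x | 1 ≤ (n + 1) * (1 - x ^ 2)}, ?_, ?_, fun x hx => ?_⟩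
  · refine ContinuousOn.congr ?_ ((spectralCutoff_eqOn S n).mono Set.inter_subset_left)
    exact (Complex.continuous_ofReal.comp (continuous_edgeCutoff n)).continuousOn
  · exact (spectrum.isCompact S).inter_right (isClosed_le (by fun_prop) (by fun_prop))
  · refine Set.inter_subset_inter_right _ fun x hx => ?_
    have hx' : (1 : ℝ) ≤ (n + 1) * (1 - x ^ 2) := hx
    have : 0 < 1 - x ^ 2 := pos_of_mul_pos_right (by linarith) hn.le
    exact abs_lt.1 ((sq_lt_one_iff_abs_lt_one _).1 (by linarith))
  · unfold spectralCutoff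
    split_ifs with hxS
    · rw [edgeCutoff_eq_zero, Complex.ofReal_zero]
      exact (not_le.1 fun h => hx ⟨hxS, h⟩).le
    · rfl

/-- Contractions converging strongly to the identity on a dense set do so everywhere. -/
theorem tendsto_apply_of_dense {E : Type*} [NormedAddCommGroup E] [InnerProductSpace ℂ E]
    {A : ℕ → E →L[ℂ] E} (hA : ∀ n, ‖A n‖ ≤ 1) {s : Set E}
    (hs : Dense s) (h : ∀ x ∈ s, Filter.Tendsto (fun n => A n x) Filter.atTop (nhds x)) (x : E) :
    Filter.Tendsto (fun n => A n x) Filter.atTop (nhds x) := by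
  rw [Metric.tendsto_atTop]
  intro ε hε
  obtain ⟨y, hys, hy⟩ := Metric.dense_iff.1 hs x (ε / 3) (by positivity)
  obtain ⟨N, hN⟩ := Metric.tendsto_atTop.1 (h y hy) (ε / 3) (by positivity)
  refine ⟨N, fun n hn => ?_⟩
  have h1 : dist (A n x) (A n y) ≤ dist x y := by
    rw [dist_eq_norm, dist_eq_norm, ← map_sub]
    simpa using (A n).le_of_opNorm_le (hA n) (x - y)
  have h2 := hN n hn
  have h3 : dist y x < ε / 3 := hys
  have h4 := dist_triangle4 (A n x) (A n y) y x
  rw [dist_comm x y] at h1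
  linarith

theorem IsBoundedTransformPair.tendsto_spectralCutoff {T : H →ₗ.[ℂ] H} {S R : H →L[ℂ] H}
    (h : IsBoundedTransformPair T S R) (x : H) :
    Filter.Tendsto (fun n => boundedCalc S (spectralCutoff S n) x) Filter.atTop (nhds x) := by
  have hS := h.isSelfAdjoint
  have hcont (n) := (memCc_spectralCutoff S n).continuousOn_spectrum
  have hdense : DenseRange (R * R) := h.denseRange.comp h.denseRange R.continuous
  refine tendsto_apply_of_dense (fun n => ?_) hdense ?_ x
  · refine norm_boundedCalc_le hS zero_le_one fun x hx => ?_
    rw [spectralCutoff_eqOn S n hx, Complex.norm_real, Real.norm_eq_abs, abs_le]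
    constructor <;> linarith [edgeCutoff_nonneg n x, edgeCutoff_le_one n x]
  · rintro _ ⟨y, rfl⟩
    have hq : ContinuousOn (fun x : ℝ => 1 - (x : ℂ) ^ 2) (spectrum ℝ S) := by fun_prop
    have key (n : ℕ) : boundedCalc S (fun x => spectralCutoff S n x * (1 - (x : ℂ) ^ 2)
        - (1 - (x : ℂ) ^ 2)) = boundedCalc S (spectralCutoff S n) * (R * R) - R * R := by
      rw [boundedCalc_sub hS (g := fun x => spectralCutoff S n x * (1 - (x : ℂ) ^ 2))
        ((hcont n).mul hq) hq, boundedCalc_mul hS (hcont n) hq,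
        boundedCalc_one_sub_sq hS, h.mul_self]
    rw [tendsto_iff_norm_sub_tendsto_zero]
    have hlim : Filter.Tendsto (fun n : ℕ => 2 / ((n : ℝ) + 1) * ‖y‖) Filter.atTop (nhds 0) := by
      have := (tendsto_one_div_add_atTop_nhds_zero_nat (𝕜 := ℝ)).const_mul 2 |>.mul_const ‖y‖
      simpa [div_eq_mul_inv] using this
    refine squeeze_zero (fun n => norm_nonneg _) (fun n => ?_) hlim
    refine ContinuousLinearMap.le_of_opNorm_le
      (boundedCalc S (spectralCutoff S n) * (R * R) - R * R) ?_ y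
    rw [← key]
    refine norm_boundedCalc_le hS (by positivity) fun x hx => ?_
    have e : spectralCutoff S n x * (1 - (x : ℂ) ^ 2) - (1 - (x : ℂ) ^ 2)
        = ((-((1 - edgeCutoff n x) * (1 - x ^ 2)) : ℝ) : ℂ) := by
      rw [spectralCutoff_eqOn S n hx]
      push_cast
      ring
    rw [e, Complex.norm_real, norm_neg, Real.norm_of_nonneg
      (mul_nonneg (sub_nonneg.2 (edgeCutoff_le_one n x)) (h.sq_le_one hx))]
    exact one_sub_edgeCutoff_mul_le n (h.sq_le_one hx)

/-- For every real-valued `f ∈ C(σ(T))`, the operator `f₀(T)` on `C*_c(S)H`, determined by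
`f₀(T) h(T)ψ = (fh)(T)ψ` for `h ∈ C_c(σ(T))`, is essentially self-adjoint: its closure
`f(T)` is self-adjoint. -/
theorem f0T_essentiallySelfAdjoint (T : H →ₗ.[ℂ] H) (S : H →L[ℂ] H)
    (hdense : Dense (T.domain : Set H)) (hsa : IsSelfAdjoint T)
    (hbt : IsBoundedTransform T S) (f : ℝ → ℂ) (hf : ContinuousOn f (realSpec T))
    (hreal : ∀ x ∈ realSpec T, (f x).im = 0) :
    ∃ A : H →ₗ.[ℂ] H, IsF0 S (realSpec T) f A ∧ A.IsClosable ∧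
      IsSelfAdjoint A.closure := by
  obtain ⟨R, hR⟩ := hbt.exists_pair hsa
  have hS := hR.isSelfAdjoint
  have hfu : ContinuousOn (fun x => f (uFun x)) (tildeSpec S) :=
    hf.comp (continuousOn_uFun.mono Set.inter_subset_right)
      fun x hx => (hR.uFun_mem_realSpec_iff hx.2).2 hx
  have hfu_star {x : ℝ} (hx : x ∈ tildeSpec S) : star (f (uFun x)) = f (uFun x) :=
    Complex.conj_eq_iff_im.2 (hreal _ ((hR.uFun_mem_realSpec_iff hx.2).2 hx))
  let ι := {g : ℝ → ℂ // MemCc g (tildeSpec S)}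
  have hc (g : ι) := g.2.continuousOn_spectrum
  have hc' (g : ι) := (g.2.mul_left hfu).continuousOn_spectrum
  obtain ⟨A, hAdom, hAapp, hAc, hAsa⟩ :=
    LinearPMap.exists_isSelfAdjoint_closure_of_approximateUnit (ι := ι)
      (fun g => boundedCalc S g.1) (fun g => boundedCalc S fun x => f (uFun x) * g.1 x)
      (fun g k => by
        rw [← boundedCalc_mul hS (hc' k) (hc g), ← boundedCalc_mul hS (hc k) (hc' g)]
        congr 1
        ext x
        ring)
      (fun g => ⟨⟨_, g.2.star⟩, boundedCalc_star _, by
        rw [← boundedCalc_star]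
        congr 1
        ext x
        by_cases hx : x ∈ tildeSpec S
        · rw [star_mul', hfu_star hx]
        · obtain ⟨-, K, -, hK, hg0⟩ := g.2
          simp [hg0 x fun h => hx (hK h)]⟩)
      (fun n => ⟨_, memCc_spectralCutoff S n⟩) hR.tendsto_spectralCutoff
  refine ⟨A, ⟨?_, fun h hh ψ => ?_⟩, hAc, hAsa⟩
  · rw [hAdom, ccSpan]
    congr 1
    ext v
    exact ⟨fun ⟨g, ψ, hv⟩ => ⟨g.1, g.2, ψ, hv⟩, fun ⟨g, hg, ψ, hv⟩ => ⟨⟨g, hg⟩, ψ, hv⟩⟩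
  · obtain ⟨hm, e⟩ := hAapp ⟨_, hR.memCc_compU hh⟩ ψ
    refine ⟨hm, e.trans ?_⟩
    have : compU (fun x => f x * h x) = fun x => f (uFun x) * compU h x := by
      ext x
      by_cases hx : x ∈ Set.Ioo (-1 : ℝ) 1 <;> simp only [compU, hx, if_true, if_false, mul_zero]
    rw [pmapCalc, this]
end
end
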